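/- arXiv:2002.09920 — 2 statements merged into one kernel-verified Lean document; each statement's English description precedes it below -/
import Mathlib

section
/- Let ε > 0 and let u : ℝ³ → ℝ be a continuous function with |u(x)| ≤ C(1+|x|) for some C > 0 and all x, satisfying the regularized integral equation u(x) = −(1/(8π)) ∫_{ℝ³} |x−y| e^{−ε|y|²} e^{u(y)} dy for every x ∈ ℝ³. Then the following Pohozaev-type identity holds: ∫_{ℝ³} ( u(x) + 6 − 4ε|x|² ) e^{−ε|x|²} e^{u(x)} dx = 0. -/
open MeasureTheory

theorem integrable_norm_sub_mul {E : Type*} [NormedAddCommGroup E] [SecondCountableTopology E]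
    [MeasurableSpace E] [BorelSpace E] {μ : Measure E} {w : E → ℝ}
    (hw : Integrable w μ) (hnw : Integrable (fun y => ‖y‖ * w y) μ)
    (x : E) : Integrable (fun y => ‖x - y‖ * w y) μ := by
  refine ((hw.norm.const_mul ‖x‖).add hnw.norm).mono'
    ((Continuous.aestronglyMeasurable (by fun_prop)).mul hw.aestronglyMeasurable)
    (Filter.Eventually.of_forall fun y => ?_)
  simp only [norm_mul, norm_norm, Pi.add_apply]
  nlinarith [norm_sub_le x y, norm_nonneg (w y)]

section NormKernel

variable {E : Type*} [NormedAddCommGroup E] [InnerProductSpace ℝ E]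

theorem hasFDerivAt_norm_of_ne_zero {z : E} (hz : z ≠ 0) :
    HasFDerivAt (fun x : E => ‖x‖) (innerSL ℝ (‖z‖⁻¹ • z)) z := by
  have h := (hasStrictFDerivAt_norm_sq z).hasFDerivAt.sqrt
    (pow_ne_zero 2 (norm_ne_zero_iff.mpr hz))
  simp only [Real.sqrt_sq (norm_nonneg _)] at h
  convert h using 1
  ext y
  simp
  ring

theorem norm_inv_norm_smul_le_one (z : E) : ‖‖z‖⁻¹ • z‖ ≤ 1 := by
  rw [norm_smul, norm_inv, norm_norm]
  exact inv_mul_le_one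

theorem norm_smul_innerSL_inv_norm_smul_le (a : ℝ) (z : E) :
    ‖a • innerSL ℝ (‖z‖⁻¹ • z)‖ ≤ ‖a‖ := by
  rw [norm_smul, innerSL_apply_norm]
  exact mul_le_of_le_one_right (norm_nonneg _) (norm_inv_norm_smul_le_one z)

theorem inner_inv_norm_smul_self (z : E) : inner ℝ (‖z‖⁻¹ • z) z = ‖z‖ := by
  rcases eq_or_ne z 0 with rfl | hz
  · simp
  · rw [inner_smul_left, real_inner_self_eq_norm_sq]
    have := norm_ne_zero_iff.mpr hz
    simp
    field_simp

variable [MeasurableSpace E] {μ : Measure E} {w : E → ℝ}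

theorem norm_integral_smul_innerSL_le (hw : Integrable w μ) (x : E) :
    ‖∫ y, w y • innerSL ℝ (‖x - y‖⁻¹ • (x - y)) ∂μ‖ ≤ ∫ y, ‖w y‖ ∂μ :=
  norm_integral_le_of_norm_le hw.norm
    (Filter.Eventually.of_forall fun _ => norm_smul_innerSL_inv_norm_smul_le _ _)

variable [BorelSpace E] [FiniteDimensional ℝ E]

theorem integrable_smul_innerSL_inv_norm_smul (hw : Integrable w μ) (x : E) :
    Integrable (fun y => w y • innerSL ℝ (‖x - y‖⁻¹ • (x - y))) μ := by
  refine hw.norm.mono' (hw.aestronglyMeasurable.smul ?_)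
    (Filter.Eventually.of_forall fun y => norm_smul_innerSL_inv_norm_smul_le _ _)
  refine (innerSL ℝ (E := E)).continuous.comp_aestronglyMeasurable ?_
  exact Measurable.aestronglyMeasurable (by fun_prop)

theorem hasFDerivAt_integral_norm_sub_mul [NullSingletonClass μ]
    (hw : Integrable w μ) (hnw : Integrable (fun y => ‖y‖ * w y) μ) (x : E) :
    HasFDerivAt (fun x => ∫ y, ‖x - y‖ * w y ∂μ)
      (∫ y, w y • innerSL ℝ (‖x - y‖⁻¹ • (x - y)) ∂μ) x := by
  refine (hasFDerivAt_integral_of_dominated_loc_of_lip (s := Set.univ) (bound := fun y => ‖w y‖)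
    Filter.univ_mem
    (Filter.Eventually.of_forall fun z => (integrable_norm_sub_mul hw hnw z).aestronglyMeasurable)
    (integrable_norm_sub_mul hw hnw x)
    (integrable_smul_innerSL_inv_norm_smul hw x).aestronglyMeasurable
    (Filter.Eventually.of_forall fun y => ?_) hw.norm ?_).2
  · refine LipschitzWith.lipschitzOnWith (LipschitzWith.of_dist_le_mul fun a b => ?_)
    rw [Real.coe_nnabs, abs_norm, Real.dist_eq, ← sub_mul, abs_mul, dist_eq_norm,
      Real.norm_eq_abs, mul_comm]
    gcongr
    simpa using abs_norm_sub_norm_le (a - y) (b - y)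
  · filter_upwards [compl_mem_ae_iff.mpr (measure_singleton (μ := μ) x)] with y hy
    have hxy : x - y ≠ 0 := sub_ne_zero.mpr fun h => hy (by simp [h])
    have h := (hasFDerivAt_norm_of_ne_zero hxy).comp x ((hasFDerivAt_id x).sub_const y)
    simpa using h.mul_const (w y)

theorem two_mul_integral_mul_radial_eq [SFinite μ]
    (hw : Integrable w μ) (hnw : Integrable (fun y => ‖y‖ * w y) μ) :
    2 * ∫ x, w x * (∫ y, w y • innerSL ℝ (‖x - y‖⁻¹ • (x - y)) ∂μ) x ∂μ
      = ∫ x, w x * ∫ y, ‖x - y‖ * w y ∂μ ∂μ := by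
  have hint : Integrable
      (fun p : E × E => w p.1 * (w p.2 * inner ℝ (‖p.1 - p.2‖⁻¹ • (p.1 - p.2)) p.1))
      (μ.prod μ) := by
    refine (hnw.norm.mul_prod hw.norm).mono' ?_ (Filter.Eventually.of_forall fun p => ?_)
    · refine hw.aestronglyMeasurable.comp_fst.mul (hw.aestronglyMeasurable.comp_snd.mul ?_)
      exact Measurable.aestronglyMeasurable (by fun_prop)
    · have h := norm_inner_le_norm (𝕜 := ℝ) (‖p.1 - p.2‖⁻¹ • (p.1 - p.2)) p.1
      have h' := mul_le_mul_of_nonneg_right (norm_inv_norm_smul_le_one (p.1 - p.2))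
        (norm_nonneg p.1)
      simp only [norm_mul, norm_norm]
      calc ‖w p.1‖ * (‖w p.2‖ * ‖inner ℝ (‖p.1 - p.2‖⁻¹ • (p.1 - p.2)) p.1‖)
          ≤ ‖w p.1‖ * (‖w p.2‖ * ‖p.1‖) := by gcongr; linarith
        _ = ‖p.1‖ * ‖w p.1‖ * ‖w p.2‖ := by ring
  have hswap := hint.swap
  have h₁ : ∫ x, w x * (∫ y, w y • innerSL ℝ (‖x - y‖⁻¹ • (x - y)) ∂μ) x ∂μ
      = ∫ p : E × E, w p.1 * (w p.2 * inner ℝ (‖p.1 - p.2‖⁻¹ • (p.1 - p.2)) p.1) ∂(μ.prod μ) := by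
    rw [integral_prod _ hint]
    refine integral_congr_ae (Filter.Eventually.of_forall fun x => ?_)
    simp only
    rw [ContinuousLinearMap.integral_apply (integrable_smul_innerSL_inv_norm_smul hw x),
      integral_const_mul]
    simp only [smul_apply, innerSL_apply_apply, smul_eq_mul]
  have h₂ := integral_prod_swap (μ := μ) (ν := μ)
    (fun p : E × E => w p.1 * (w p.2 * inner ℝ (‖p.1 - p.2‖⁻¹ • (p.1 - p.2)) p.1))
  have hsum : ∀ p : E × E,
      w p.1 * (w p.2 * inner ℝ (‖p.1 - p.2‖⁻¹ • (p.1 - p.2)) p.1)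
        + w p.2 * (w p.1 * inner ℝ (‖p.2 - p.1‖⁻¹ • (p.2 - p.1)) p.2)
      = w p.1 * (‖p.1 - p.2‖ * w p.2) := fun p => by
    have h := inner_inv_norm_smul_self (p.1 - p.2)
    rw [inner_sub_right] at h
    rw [← neg_sub p.1 p.2, norm_neg, smul_neg, inner_neg_left]
    linear_combination w p.1 * w p.2 * h
  have hint' : Integrable (fun p : E × E => w p.1 * (‖p.1 - p.2‖ * w p.2)) (μ.prod μ) :=
    (hint.add hswap).congr (Filter.Eventually.of_forall hsum)
  rw [h₁, two_mul]
  nth_rewrite 2 [← h₂]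
  refine (integral_add hint hswap).symm.trans ?_
  calc _ = ∫ p : E × E, w p.1 * (‖p.1 - p.2‖ * w p.2) ∂(μ.prod μ) :=
        integral_congr_ae (Filter.Eventually.of_forall hsum)
    _ = _ := by
        rw [integral_prod _ hint']
        simp only [integral_const_mul]

end NormKernel

theorem integral_fderiv_apply_self_eq {n : ℕ} {w : EuclideanSpace ℝ (Fin n) → ℝ}
    (hd : Differentiable ℝ w) (hw : Integrable w) (hnw : Integrable fun x => ‖x‖ * w x)
    (hdw : Integrable fun x => ‖x‖ * ‖fderiv ℝ w x‖) :
    ∫ x, fderiv ℝ w x x = -(n * ∫ x, w x) := by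
  have hcoord : ∀ i (x : EuclideanSpace ℝ (Fin n)),
      HasFDerivAt (fun x : EuclideanSpace ℝ (Fin n) => x i)
        (EuclideanSpace.proj i : EuclideanSpace ℝ (Fin n) →L[ℝ] ℝ) x :=
    fun i x => (EuclideanSpace.proj i : EuclideanSpace ℝ (Fin n) →L[ℝ] ℝ).hasFDerivAt
  have hint : ∀ i, Integrable fun x : EuclideanSpace ℝ (Fin n) =>
      x i * fderiv ℝ w x (EuclideanSpace.single i 1) := fun i => by
    refine hdw.mono' ((Continuous.aestronglyMeasurable (by fun_prop)).mul
      (measurable_fderiv_apply_const ℝ w _).aestronglyMeasurable)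
      (Filter.Eventually.of_forall fun x => ?_)
    rw [norm_mul]
    gcongr
    · exact PiLp.norm_apply_le x i
    · simpa using (fderiv ℝ w x).le_opNorm (EuclideanSpace.single i 1)
  have hparts : ∀ i, ∫ x : EuclideanSpace ℝ (Fin n),
      x i * fderiv ℝ w x (EuclideanSpace.single i 1) = -∫ x, w x := fun i => by
    have h := integral_mul_fderiv_eq_neg_fderiv_mul_of_integrable (μ := volume)
      (f := fun x : EuclideanSpace ℝ (Fin n) => x i) (g := w) (v := EuclideanSpace.single i 1)
      (by simpa [(hcoord i _).fderiv] using hw) (hint i)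
      (hnw.norm.mono' ((Continuous.aestronglyMeasurable (by fun_prop)).mul
          hw.aestronglyMeasurable) (Filter.Eventually.of_forall fun x => by
        simp only [norm_mul, norm_norm]
        gcongr
        exact PiLp.norm_apply_le x i))
      (fun x _ => (hcoord i x).differentiableAt) (fun x _ => hd x)
    simpa [(hcoord i _).fderiv] using h
  have hsum : ∀ x : EuclideanSpace ℝ (Fin n),
      fderiv ℝ w x x = ∑ i, x i * fderiv ℝ w x (EuclideanSpace.single i 1) := fun x => by
    have h := congrArg (fderiv ℝ w x) ((EuclideanSpace.basisFun (Fin n) ℝ).sum_repr x)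
    simpa using h.symm
  simp_rw [hsum]
  rw [integral_finsetSum _ fun i _ => hint i]
  simp [hparts]

theorem integrable_exp_neg_mul_norm_sq {V : Type*} [NormedAddCommGroup V] [InnerProductSpace ℝ V]
    [FiniteDimensional ℝ V] [MeasurableSpace V] [BorelSpace V] {b : ℝ} (hb : 0 < b) :
    Integrable fun x : V => Real.exp (-b * ‖x‖ ^ 2) := by
  have h := (GaussianFourier.integrable_cexp_neg_mul_sq_norm_add (V := V) (b := (b : ℂ))
    (by simpa using hb) 0 0).norm
  refine h.congr (Filter.Eventually.of_forall fun x => ?_)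
  simp only [Complex.norm_exp]
  norm_cast
  simp

theorem integrable_one_add_norm_sq_mul_exp {V : Type*} [NormedAddCommGroup V]
    [InnerProductSpace ℝ V] [FiniteDimensional ℝ V] [MeasurableSpace V] [BorelSpace V]
    {ε C : ℝ} (hε : 0 < ε) {u : V → ℝ} (hu : Continuous u)
    (hgrowth : ∀ x, |u x| ≤ C * (1 + ‖x‖)) :
    Integrable fun x => (1 + ‖x‖) ^ 2 * (Real.exp (-ε * ‖x‖ ^ 2) * Real.exp (u x)) := by
  refine ((integrable_exp_neg_mul_norm_sq (V := V) (half_pos hε)).const_mul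
    (Real.exp (C + (C + 2) ^ 2 / (2 * ε)))).mono'
    (Continuous.aestronglyMeasurable (by fun_prop)) (Filter.Eventually.of_forall fun x => ?_)
  rw [Real.norm_of_nonneg (by positivity)]
  have h₁ : (1 + ‖x‖) ^ 2 ≤ Real.exp (2 * ‖x‖) := by
    rw [two_mul, Real.exp_add, ← sq]
    gcongr
    linarith [Real.add_one_le_exp ‖x‖]
  calc _ ≤ Real.exp (2 * ‖x‖) * (Real.exp (-ε * ‖x‖ ^ 2) * Real.exp (u x)) := by gcongr
    _ ≤ _ := by
      simp only [← Real.exp_add]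
      rw [Real.exp_le_exp]
      have h₂ := (le_abs_self _).trans (hgrowth x)
      have h₃ : (C + 2) * ‖x‖ ≤ (C + 2) ^ 2 / (2 * ε) + ε / 2 * ‖x‖ ^ 2 := by
        have : (C + 2) ^ 2 / (2 * ε) + ε / 2 * ‖x‖ ^ 2 - (C + 2) * ‖x‖
            = (C + 2 - ε * ‖x‖) ^ 2 / (2 * ε) := by
          field_simp
          ring
        have : 0 ≤ (C + 2 - ε * ‖x‖) ^ 2 / (2 * ε) := by positivity
        linarith
      linarith

/-- Pohozaev-type identity for the regularized 3D Liouville integral equation: if `u : ℝ³ → ℝ`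
is continuous, grows at most linearly, and satisfies
`u(x) = −(1/(8π)) ∫_{ℝ³} |x−y| e^{−ε|y|²} e^{u(y)} dy` for all `x`, then
`∫_{ℝ³} (u(x) + 6 − 4ε|x|²) e^{−ε|x|²} e^{u(x)} dx = 0`. -/
theorem stmt11 (ε : ℝ) (hε : 0 < ε) (u : EuclideanSpace ℝ (Fin 3) → ℝ)
    (hu : Continuous u) (C : ℝ) (hC : 0 < C)
    (hgrowth : ∀ x : EuclideanSpace ℝ (Fin 3), |u x| ≤ C * (1 + ‖x‖))
    (heq : ∀ x : EuclideanSpace ℝ (Fin 3),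
      u x = -(1 / (8 * Real.pi)) *
        ∫ y : EuclideanSpace ℝ (Fin 3), ‖x - y‖ * Real.exp (-ε * ‖y‖ ^ 2) * Real.exp (u y)) :
    (∫ x : EuclideanSpace ℝ (Fin 3),
      (u x + 6 - 4 * ε * ‖x‖ ^ 2) * Real.exp (-ε * ‖x‖ ^ 2) * Real.exp (u x)) = 0 := by
  set w : EuclideanSpace ℝ (Fin 3) → ℝ :=
    fun x => Real.exp (-ε * ‖x‖ ^ 2) * Real.exp (u x) with hw_def
  have hw_pos : ∀ x, 0 < w x := fun x => by positivity
  have hw_cont : Continuous w := by fun_prop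
  have hdom := integrable_one_add_norm_sq_mul_exp hε hu hgrowth
  have hint : ∀ f : EuclideanSpace ℝ (Fin 3) → ℝ, AEStronglyMeasurable f volume →
      ∀ K : ℝ, (∀ x, |f x| ≤ K * (1 + ‖x‖) ^ 2) → Integrable fun x => f x * w x :=
    fun f hf K hK => by
      refine (hdom.const_mul K).mono' (hf.mul hw_cont.aestronglyMeasurable)
        (Filter.Eventually.of_forall fun x => ?_)
      change ‖f x * w x‖ ≤ K * ((1 + ‖x‖) ^ 2 * w x)
      rw [norm_mul, Real.norm_eq_abs, Real.norm_of_nonneg (hw_pos x).le]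
      exact (mul_le_mul_of_nonneg_right (hK x) (hw_pos x).le).trans_eq (mul_assoc _ _ _)
  have hw : Integrable w := by
    simpa using hint (fun _ => 1) aestronglyMeasurable_const 1
      fun x => by simp only [abs_one]; nlinarith [norm_nonneg x]
  have hnw : Integrable fun x => ‖x‖ * w x :=
    hint _ continuous_norm.aestronglyMeasurable 1
      fun x => by rw [abs_norm]; nlinarith [norm_nonneg x]
  have hsw : Integrable fun x => ‖x‖ ^ 2 * w x :=
    hint _ (continuous_norm.pow 2).aestronglyMeasurable 1
      fun x => by rw [abs_of_nonneg (by positivity)]; nlinarith [norm_nonneg x]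
  have huw : Integrable fun x => u x * w x :=
    hint _ hu.aestronglyMeasurable C
      fun x => (hgrowth x).trans (mul_le_mul_of_nonneg_left (by nlinarith [norm_nonneg x]) hC.le)
  set c : ℝ := -(1 / (8 * Real.pi))
  set L : EuclideanSpace ℝ (Fin 3) → EuclideanSpace ℝ (Fin 3) →L[ℝ] ℝ :=
    fun x => ∫ y, w y • innerSL ℝ (‖x - y‖⁻¹ • (x - y))
  have heq' : u = fun x => c * ∫ y, ‖x - y‖ * w y := by
    funext x
    rw [heq x]
    simp only [hw_def, mul_assoc]
  have hdu : ∀ x, HasFDerivAt u (c • L x) x := fun x => by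
    have h := (hasFDerivAt_integral_norm_sub_mul hw hnw x).const_mul c
    rwa [← heq'] at h
  have hdw : ∀ x, HasFDerivAt w (w x • (c • L x - (2 * ε) • innerSL ℝ x)) x := fun x => by
    have h := (((hasStrictFDerivAt_norm_sq x).hasFDerivAt.const_mul (-ε)).exp).mul (hdu x).exp
    refine h.congr_fderiv ?_
    ext y
    simp [hw_def]
    ring
  have hself : ∀ x, fderiv ℝ w x x = c * (w x * L x x) - 2 * ε * (‖x‖ ^ 2 * w x) := fun x => by
    rw [(hdw x).fderiv]
    simp
    ring
  have hL : ∀ x, ‖L x‖ ≤ ∫ y, ‖w y‖ := norm_integral_smul_innerSL_le hw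
  have hdiv := integral_fderiv_apply_self_eq (fun x => (hdw x).differentiableAt) hw hnw (by
    refine (hdom.const_mul (|c| * (∫ y, ‖w y‖) + 2 * ε)).mono'
      (continuous_norm.aestronglyMeasurable.mul
        (measurable_fderiv ℝ w).norm.aestronglyMeasurable)
      (Filter.Eventually.of_forall fun x => ?_)
    have h : ‖fderiv ℝ w x‖ ≤ w x * (|c| * (∫ y, ‖w y‖) + 2 * ε * ‖x‖) := by
      rw [(hdw x).fderiv, norm_smul, Real.norm_of_nonneg (hw_pos x).le]
      refine mul_le_mul_of_nonneg_left ((norm_sub_le _ _).trans ?_) (hw_pos x).le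
      rw [norm_smul, norm_smul, innerSL_apply_norm, Real.norm_eq_abs, Real.norm_eq_abs,
        abs_of_pos (by positivity : 0 < 2 * ε)]
      gcongr
      exact hL x
    rw [norm_mul, norm_norm, norm_norm]
    have hr := norm_nonneg x
    have hb : ‖x‖ * (|c| * (∫ y, ‖w y‖) + 2 * ε * ‖x‖)
        ≤ (|c| * (∫ y, ‖w y‖) + 2 * ε) * (1 + ‖x‖) ^ 2 := by
      have : 0 ≤ |c| * ∫ y, ‖w y‖ := by positivity
      have h₁ : ‖x‖ ≤ (1 + ‖x‖) ^ 2 := by nlinarith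
      have h₂ : ‖x‖ ^ 2 ≤ (1 + ‖x‖) ^ 2 := by nlinarith
      nlinarith [mul_le_mul_of_nonneg_left h₁ this, mul_le_mul_of_nonneg_left h₂ hε.le]
    calc ‖x‖ * ‖fderiv ℝ w x‖ ≤ ‖x‖ * (w x * (|c| * (∫ y, ‖w y‖) + 2 * ε * ‖x‖)) := by gcongr
      _ = ‖x‖ * (|c| * (∫ y, ‖w y‖) + 2 * ε * ‖x‖) * w x := by ring
      _ ≤ (|c| * (∫ y, ‖w y‖) + 2 * ε) * (1 + ‖x‖) ^ 2 * w x :=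
        mul_le_mul_of_nonneg_right hb (hw_pos x).le
      _ = _ := by rw [mul_assoc])
  have hLmeas : Measurable fun x => c * L x x := by
    have h : (fun x => c * L x x) = fun x => fderiv ℝ u x x := by
      funext x
      rw [(hdu x).fderiv]
      simp
    rw [h]
    exact isBoundedBilinearMap_apply.continuous.measurable.comp
      ((measurable_fderiv ℝ u).prodMk measurable_id)
  have hLint : Integrable fun x => c * (w x * L x x) := by
    refine (hint _ hLmeas.aestronglyMeasurable (|c| * ∫ y, ‖w y‖) fun x => ?_).congr
      (Filter.Eventually.of_forall fun x => by ring)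
    rw [abs_mul, mul_assoc]
    refine mul_le_mul_of_nonneg_left ?_ (abs_nonneg c)
    calc |L x x| ≤ ‖L x‖ * ‖x‖ := (L x).le_opNorm x
      _ ≤ (∫ y, ‖w y‖) * (1 + ‖x‖) ^ 2 := by
        gcongr
        · exact hL x
        · nlinarith [norm_nonneg x]
  have hrad : 2 * (c * ∫ x, w x * L x x) = ∫ x, u x * w x := by
    rw [mul_left_comm, two_mul_integral_mul_radial_eq hw hnw, ← integral_const_mul]
    refine integral_congr_ae (Filter.Eventually.of_forall fun x => ?_)
    have := congrFun heq' x
    simp only at this ⊢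
    rw [this]
    ring
  simp_rw [hself] at hdiv
  rw [integral_sub hLint (hsw.const_mul _), integral_const_mul, integral_const_mul] at hdiv
  calc _ = ∫ x, (u x * w x + 6 * w x) - 4 * ε * (‖x‖ ^ 2 * w x) := by
        refine integral_congr_ae (Filter.Eventually.of_forall fun x => ?_)
        simp only [hw_def]
        ring
    _ = 0 := by
        have h := integral_sub (huw.add (hw.const_mul 6)) (hsw.const_mul (4 * ε))
        simp only [Pi.add_apply] at h
        rw [h, integral_add huw (hw.const_mul 6), integral_const_mul, integral_const_mul, ← hrad]
        push_cast at hdiv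
        linarith
end

section
/- Let g : [0,∞) → [0,∞) be a measurable function and let x ∈ ℝ³ with |x| = r > 0. Then (as an identity in [0, +∞]) ∫_{ℝ³} |x−y| g(|y|) dy = (4π/(3r)) ∫₀^r s²(3r² + s²) g(s) ds + (4π/3) ∫_r^{+∞} s(r² + 3s²) g(s) ds. -/
open MeasureTheory

theorem lintegral_prod_comp_sqrt_sq_add_sq {f : ℝ → ENNReal} (hf : Measurable f) :
    ∫⁻ p : ℝ × ℝ, f (√(p.1 ^ 2 + p.2 ^ 2)) =
      ∫⁻ ρ in Set.Ioi (0 : ℝ), ENNReal.ofReal (2 * Real.pi * ρ) * f ρ := by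
  rw [← lintegral_comp_polarCoord_symm]
  have hT : MeasurableSet polarCoord.target := polarCoord.open_target.measurableSet
  have h1 : ∀ p ∈ polarCoord.target,
      ENNReal.ofReal p.1 • f (√((polarCoord.symm p).1 ^ 2 + (polarCoord.symm p).2 ^ 2)) =
        ENNReal.ofReal p.1 * f p.1 := by
    rintro ⟨ρ, φ⟩ ⟨hρ, -⟩
    have hρ' : 0 < ρ := hρ
    have : (ρ * Real.cos φ) ^ 2 + (ρ * Real.sin φ) ^ 2 = ρ ^ 2 := by
      linear_combination ρ ^ 2 * Real.sin_sq_add_cos_sq φ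
    simp only [polarCoord, OpenPartialHomeomorph.coe_mk_symm, PartialEquiv.coe_symm_mk,
      smul_eq_mul]
    rw [this, Real.sqrt_sq hρ'.le]
  rw [setLIntegral_congr_fun hT h1]
  change ∫⁻ p in Set.Ioi (0 : ℝ) ×ˢ Set.Ioo (-Real.pi) Real.pi, _ ∂(volume.prod volume) = _
  rw [setLIntegral_prod _ (by fun_prop)]
  refine setLIntegral_congr_fun measurableSet_Ioi fun ρ hρ => ?_
  simp only [lintegral_const, Measure.restrict_apply, MeasurableSet.univ, Set.univ_inter,
    Real.volume_Ioo]
  rw [mul_right_comm, ← ENNReal.ofReal_mul (le_of_lt hρ)]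
  ring_nf

theorem lintegral_euclideanSpace_three_eq_prod {G : ℝ → ℝ → ENNReal}
    (hG : Measurable (Function.uncurry G)) :
    ∫⁻ y : EuclideanSpace ℝ (Fin 3), G (y 0) ‖y‖ =
      ∫⁻ z : ℝ, ∫⁻ p : ℝ × ℝ, G z (√(z ^ 2 + (p.1 ^ 2 + p.2 ^ 2))) := by
  have hG' : ∀ {α : Type} [MeasurableSpace α] {u v : α → ℝ}, Measurable u → Measurable v →
      Measurable fun a => G (u a) (v a) := fun hu hv => hG.comp (hu.prodMk hv)
  have e1 := (EuclideanSpace.volume_preserving_symm_measurableEquiv_toLp (Fin 3))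
  have e2 := volume_preserving_piFinSuccAbove (fun _ : Fin 3 => ℝ) 0
  have e3 := (MeasurePreserving.id (volume : Measure ℝ)).prod (volume_preserving_finTwoArrow ℝ)
  have e := e3.comp (e2.comp e1)
  have hmeas : Measurable fun q : ℝ × ℝ × ℝ => G q.1 (√(q.1 ^ 2 + (q.2.1 ^ 2 + q.2.2 ^ 2))) :=
    hG' (by fun_prop) (by fun_prop)
  rw [← lintegral_prod (μ := volume) (ν := volume)
    (fun q : ℝ × ℝ × ℝ => G q.1 (√(q.1 ^ 2 + (q.2.1 ^ 2 + q.2.2 ^ 2)))) hmeas.aemeasurable,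
    ← e.lintegral_comp hmeas]
  refine lintegral_congr fun y => ?_
  rw [EuclideanSpace.norm_eq, Fin.sum_univ_three]
  simp only [Real.norm_eq_abs, sq_abs, add_assoc]
  rfl

/-- Spherical coordinates in `ℝ³` for functions of the first coordinate and the norm. -/
theorem lintegral_euclideanSpace_three_spherical {G : ℝ → ℝ → ENNReal}
    (hG : Measurable (Function.uncurry G)) :
    ∫⁻ y : EuclideanSpace ℝ (Fin 3), G (y 0) ‖y‖ =
      ∫⁻ s in Set.Ioi (0 : ℝ), ∫⁻ θ in Set.Ioo 0 Real.pi,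
        ENNReal.ofReal (2 * Real.pi * s ^ 2 * Real.sin θ) * G (s * Real.cos θ) s := by
  have hG' : ∀ {α : Type} [MeasurableSpace α] {u v : α → ℝ}, Measurable u → Measurable v →
      Measurable fun a => G (u a) (v a) := fun hu hv => hG.comp (hu.prodMk hv)
  let H : ℝ × ℝ → ENNReal := fun q => (Set.Ioi (0 : ℝ)).indicator
    (fun ρ => ENNReal.ofReal (2 * Real.pi * ρ) * G q.1 (√(q.1 ^ 2 + ρ ^ 2))) q.2
  have hH : Measurable H := by
    have : H = {q : ℝ × ℝ | 0 < q.2}.indicator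
        (fun q => ENNReal.ofReal (2 * Real.pi * q.2) * G q.1 (√(q.1 ^ 2 + q.2 ^ 2))) := by
      ext q; simp [H, Set.indicator]
    rw [this]
    refine Measurable.indicator ?_ (measurableSet_lt measurable_const measurable_snd)
    exact Measurable.mul (by fun_prop) (hG' (by fun_prop) (by fun_prop))
  have h1 : ∀ z : ℝ, ∫⁻ p : ℝ × ℝ, G z (√(z ^ 2 + (p.1 ^ 2 + p.2 ^ 2))) =
      ∫⁻ ρ : ℝ, H (z, ρ) := by
    intro z
    have hf : Measurable fun ρ : ℝ => G z (√(z ^ 2 + ρ ^ 2)) := hG' (by fun_prop) (by fun_prop)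
    have := lintegral_prod_comp_sqrt_sq_add_sq hf
    simp only [Real.sq_sqrt (add_nonneg (sq_nonneg _) (sq_nonneg _))] at this
    rw [this, ← lintegral_indicator measurableSet_Ioi]
  rw [lintegral_euclideanSpace_three_eq_prod hG, lintegral_congr h1,
    ← lintegral_prod (μ := volume) (ν := volume) H hH.aemeasurable]
  change ∫⁻ q : ℝ × ℝ, H q = _
  rw [← lintegral_comp_polarCoord_symm]
  have hsymm : ∀ s θ : ℝ, polarCoord.symm (s, θ) = (s * Real.cos θ, s * Real.sin θ) :=
    fun _ _ => rfl
  have hmeas : Measurable fun q : ℝ × ℝ => ENNReal.ofReal q.1 • H (polarCoord.symm q) := by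
    have : Measurable fun q : ℝ × ℝ => (q.1 * Real.cos q.2, q.1 * Real.sin q.2) := by fun_prop
    exact Measurable.mul (by fun_prop) (hH.comp this)
  change ∫⁻ q in Set.Ioi (0 : ℝ) ×ˢ Set.Ioo (-Real.pi) Real.pi, _ ∂(volume.prod volume) = _
  rw [setLIntegral_prod _ hmeas.aemeasurable]
  refine setLIntegral_congr_fun measurableSet_Ioi fun s hs => ?_
  have hs' : 0 < s := hs
  rw [← lintegral_indicator measurableSet_Ioo, ← lintegral_indicator measurableSet_Ioo]
  refine lintegral_congr fun θ => ?_
  by_cases hθ : θ ∈ Set.Ioo 0 Real.pi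
  · have hsin : 0 < Real.sin θ := Real.sin_pos_of_mem_Ioo hθ
    have hθ2 : θ ∈ Set.Ioo (-Real.pi) Real.pi := ⟨by linarith [hθ.1, Real.pi_pos], hθ.2⟩
    have hnorm : (s * Real.cos θ) ^ 2 + (s * Real.sin θ) ^ 2 = s ^ 2 := by
      linear_combination s ^ 2 * Real.sin_sq_add_cos_sq θ
    rw [Set.indicator_of_mem hθ2, Set.indicator_of_mem hθ, hsymm]
    simp only [H]
    rw [Set.indicator_of_mem (Set.mem_Ioi.2 (mul_pos hs' hsin)), hnorm, Real.sqrt_sq hs'.le,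
      smul_eq_mul, ← mul_assoc, ← ENNReal.ofReal_mul hs'.le]
    ring_nf
  · rw [Set.indicator_of_notMem hθ]
    by_cases hθ2 : θ ∈ Set.Ioo (-Real.pi) Real.pi
    · have hsin : Real.sin θ ≤ 0 :=
        Real.sin_nonpos_of_nonpos_of_neg_pi_le
          (not_lt.1 fun h => hθ ⟨h, hθ2.2⟩) hθ2.1.le
      rw [Set.indicator_of_mem hθ2, hsymm]
      simp only [H]
      rw [Set.indicator_of_notMem, smul_zero]
      exact not_lt.2 (mul_nonpos_of_nonneg_of_nonpos hs'.le hsin)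
    · rw [Set.indicator_of_notMem hθ2]

theorem lintegral_sin_mul_sqrt {r s : ℝ} (hr : 0 < r) (hs : 0 < s) :
    ∫⁻ θ in Set.Ioo 0 Real.pi,
        ENNReal.ofReal (Real.sin θ * √(r ^ 2 - 2 * r * (s * Real.cos θ) + s ^ 2)) =
      ENNReal.ofReal (((r + s) ^ 3 - |r - s| ^ 3) / (3 * r * s)) := by
  let u : ℝ → ℝ := fun θ => r ^ 2 - 2 * r * (s * Real.cos θ) + s ^ 2
  have hcont : Continuous fun θ => Real.sin θ * √(u θ) := by fun_prop
  have hderiv : ∀ θ ∈ Set.Ioo 0 Real.pi,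
      HasDerivAt (fun θ => u θ * √(u θ) / (3 * r * s)) (Real.sin θ * √(u θ)) θ := by
    intro θ hθ
    have hsin : 0 < Real.sin θ := Real.sin_pos_of_mem_Ioo hθ
    have hu : 0 < u θ := by
      have : u θ = (r - s * Real.cos θ) ^ 2 + (s * Real.sin θ) ^ 2 := by
        simp only [u]; linear_combination (-s ^ 2) * Real.sin_sq_add_cos_sq θ
      rw [this]; positivity
    have hdu : HasDerivAt u (2 * r * s * Real.sin θ) θ := by
      have := (((((Real.hasDerivAt_cos θ).const_mul s).const_mul (2 * r)).const_sub
        (r ^ 2)).add_const (s ^ 2))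
      convert! this using 1
      ring
    convert! (hdu.mul (hdu.sqrt hu.ne')).div_const (3 * r * s) using 1
    have hq : √(u θ) ≠ 0 := (Real.sqrt_pos.2 hu).ne'
    have hq2 : u θ = √(u θ) ^ 2 := (Real.sq_sqrt hu.le).symm
    set w := √(u θ)
    rw [hq2]
    field_simp
    ring
  have hint := intervalIntegral.integral_eq_sub_of_hasDerivAt_of_le Real.pi_pos.le
    (by fun_prop) hderiv (hcont.intervalIntegrable _ _)
  rw [intervalIntegral.integral_of_le Real.pi_pos.le, integral_Ioc_eq_integral_Ioo] at hint
  rw [← ofReal_integral_eq_lintegral_ofReal]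
  · change ENNReal.ofReal (∫ θ in Set.Ioo 0 Real.pi, Real.sin θ * √(u θ)) = _
    rw [hint]
    have h0 : u 0 = |r - s| ^ 2 := by simp [u]; ring
    have hpi : u Real.pi = (r + s) ^ 2 := by simp [u]; ring
    rw [h0, hpi, Real.sqrt_sq (abs_nonneg _), Real.sqrt_sq (by positivity)]
    ring_nf
  · exact (hcont.integrableOn_Icc (a := 0) (b := Real.pi)).mono_set Set.Ioo_subset_Icc_self
  · refine (ae_restrict_iff' measurableSet_Ioo).2 (Filter.Eventually.of_forall fun θ hθ => ?_)
    exact mul_nonneg (Real.sin_pos_of_mem_Ioo hθ).le (Real.sqrt_nonneg _)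

theorem lintegral_norm_single_sub_mul {g : ℝ → ℝ} (hg : Measurable g) (hg0 : ∀ s, 0 ≤ g s)
    {r : ℝ} (hr : 0 < r) :
    ∫⁻ y : EuclideanSpace ℝ (Fin 3),
        ENNReal.ofReal (‖EuclideanSpace.single 0 r - y‖ * g ‖y‖) =
      ∫⁻ s in Set.Ioi (0 : ℝ), ENNReal.ofReal
        (2 * Real.pi * s * (((r + s) ^ 3 - |r - s| ^ 3) / (3 * r)) * g s) := by
  have hnorm : ∀ y : EuclideanSpace ℝ (Fin 3), ‖EuclideanSpace.single 0 r - y‖ =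
      √(r ^ 2 - 2 * r * y 0 + ‖y‖ ^ 2) := by
    intro y
    rw [EuclideanSpace.norm_eq, EuclideanSpace.norm_sq_eq, Fin.sum_univ_three, Fin.sum_univ_three]
    congr 1
    simp
    ring
  simp_rw [hnorm]
  rw [lintegral_euclideanSpace_three_spherical
    (G := fun z s => ENNReal.ofReal (√(r ^ 2 - 2 * r * z + s ^ 2) * g s))
    (by simp only [Function.uncurry_def]; fun_prop)]
  refine setLIntegral_congr_fun measurableSet_Ioi fun s hs => ?_
  have hs' : 0 < s := hs
  have hc : 0 ≤ 2 * Real.pi * s ^ 2 * g s := mul_nonneg (by positivity) (hg0 s)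
  have h : ∀ θ ∈ Set.Ioo 0 Real.pi, ENNReal.ofReal (2 * Real.pi * s ^ 2 * Real.sin θ) *
      ENNReal.ofReal (√(r ^ 2 - 2 * r * (s * Real.cos θ) + s ^ 2) * g s) =
      ENNReal.ofReal (2 * Real.pi * s ^ 2 * g s) *
        ENNReal.ofReal (Real.sin θ * √(r ^ 2 - 2 * r * (s * Real.cos θ) + s ^ 2)) := by
    intro θ hθ
    have hsin := Real.sin_pos_of_mem_Ioo hθ
    rw [← ENNReal.ofReal_mul (by positivity), ← ENNReal.ofReal_mul hc]
    congr 1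
    ring
  rw [setLIntegral_congr_fun measurableSet_Ioo h, lintegral_const_mul _ (by fun_prop),
    lintegral_sin_mul_sqrt hr hs', ← ENNReal.ofReal_mul hc]
  congr 1
  field_simp


/-- Radial reduction of the convolution with the kernel `|x−y|` in `ℝ³`: for a measurable
nonnegative `g` and `x ∈ ℝ³` with `|x| = r > 0`, as an identity in `[0,∞]`,
`∫_{ℝ³} |x−y| g(|y|) dy = (4π/(3r)) ∫₀^r s²(3r²+s²) g(s) ds + (4π/3) ∫_r^∞ s(r²+3s²) g(s) ds`. -/
theorem stmt12 (g : ℝ → ℝ) (hg : Measurable g) (hg0 : ∀ s : ℝ, 0 ≤ g s)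
    (x : EuclideanSpace ℝ (Fin 3)) (r : ℝ) (hr : r = ‖x‖) (hrpos : 0 < r) :
    (∫⁻ y : EuclideanSpace ℝ (Fin 3), ENNReal.ofReal (‖x - y‖ * g ‖y‖)) =
      ENNReal.ofReal (4 * Real.pi / (3 * r)) *
          (∫⁻ s in Set.Ioc (0 : ℝ) r, ENNReal.ofReal (s ^ 2 * (3 * r ^ 2 + s ^ 2) * g s))
        + ENNReal.ofReal (4 * Real.pi / 3) *
          (∫⁻ s in Set.Ioi r, ENNReal.ofReal (s * (r ^ 2 + 3 * s ^ 2) * g s)) := by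
  set e : EuclideanSpace ℝ (Fin 3) := EuclideanSpace.single 0 r with he
  have hnorm : ‖e‖ = ‖x‖ := by
    rw [he, PiLp.norm_single, Real.norm_eq_abs, abs_of_pos hrpos, hr]
  let R := (ℝ ∙ (e - x))ᗮ.reflection
  have hR : R e = x := Submodule.reflection_sub hnorm
  rw [← R.measurePreserving.lintegral_comp (by fun_prop)]
  simp_rw [← hR, ← map_sub, LinearIsometryEquiv.norm_map]
  rw [he, lintegral_norm_single_sub_mul hg hg0 hrpos, ← Set.Ioc_union_Ioi_eq_Ioi hrpos.le,
    lintegral_union measurableSet_Ioi (Set.Ioc_disjoint_Ioi le_rfl),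
    ← lintegral_const_mul _ (by fun_prop), ← lintegral_const_mul _ (by fun_prop)]
  congr 1
  · refine setLIntegral_congr_fun measurableSet_Ioc fun s hs => ?_
    rw [← ENNReal.ofReal_mul (by positivity), abs_of_nonneg (sub_nonneg.2 hs.2)]
    congr 1
    field_simp
    ring
  · refine setLIntegral_congr_fun measurableSet_Ioi fun s hs => ?_
    rw [← ENNReal.ofReal_mul (by positivity), abs_of_neg (sub_neg.2 hs)]
    congr 1
    field_simp
    ring
end
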